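/- If M ∈ 𝓜^sh and A, B are Borel sets of finite unit partition number with Z(B, M) > 0, then z(A, B) := Z(A ∪ B, M)/Z(B, M) ≤ 1, i.e. Z(A ∪ B, M) ≤ Z(B, M). -/

import Mathlib

open MeasureTheory Metric

/-- Indicator of 1-hard-core tuples: `1` iff all pairs of distinct coordinates are at
distance at least one. (`h_0 = 1` by the empty quantification.) -/
noncomputable def hardCore {X : Type*} [MetricSpace X] (n : ℕ) (x : Fin n → X) : ℝ :=
  if ∀ i j : Fin n, i ≠ j → 1 ≤ dist (x i) (x j) then 1 else 0

/-- The generating function `Z(B, M)` of weighted 1-hard-core configurations. -/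
noncomputable def genZ {X : Type*} [MetricSpace X] [MeasurableSpace X]
    (B : Set X) (M : Measure X) : ℝ :=
  ∑' n : ℕ, ((-1 : ℝ) ^ n / n.factorial) *
    ∫ x in (Set.univ.pi fun _ : Fin n => B), hardCore n x ∂(Measure.pi fun _ : Fin n => M)

/-- The unit partition number `κ(B)`: the least `k` such that `B` is a disjoint union of
`k` Borel sets of diameter less than one (`⊤` if there is no such finite partition). -/
noncomputable def kappa {X : Type*} [MetricSpace X] [MeasurableSpace X] (B : Set X) : ℕ∞ :=
  sInf {k : ℕ∞ | ∃ m : ℕ, k = (m : ℕ∞) ∧ ∃ A : Fin m → Set X,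
    (∀ i, MeasurableSet (A i)) ∧ (∀ i, EMetric.diam (A i) < 1) ∧
    Pairwise (Function.onFun Disjoint A) ∧ B = ⋃ i, A i}

section HardCore

variable {X : Type*} [MetricSpace X]

lemma hardCore_nonneg (n : ℕ) (x : Fin n → X) : 0 ≤ hardCore n x := by
  unfold hardCore; split_ifs <;> norm_num

lemma hardCore_le_one (n : ℕ) (x : Fin n → X) : hardCore n x ≤ 1 := by
  unfold hardCore; split_ifs <;> norm_num

open Classical in
/-- Inserting a point into a hard-core tuple. -/
lemma hardCore_insertNth {n : ℕ} (i : Fin (n + 1)) (a : X) (y : Fin n → X) :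
    hardCore (n + 1) (i.insertNth a y : Fin (n + 1) → X) =
      if ∀ j, y j ∉ ball a 1 then hardCore n y else 0 := by
  have key : (∀ k l : Fin (n + 1), k ≠ l →
      1 ≤ dist ((i.insertNth a y : Fin (n + 1) → X) k) ((i.insertNth a y : Fin (n + 1) → X) l)) ↔
      (∀ j, y j ∉ ball a 1) ∧ ∀ k l : Fin n, k ≠ l → 1 ≤ dist (y k) (y l) := by
    simp only [mem_ball, not_lt]
    constructor
    · intro h
      refine ⟨fun j => ?_, fun k l hkl => ?_⟩
      · simpa using h (i.succAbove j) i (Fin.succAbove_ne i j)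
      · simpa using h (i.succAbove k) (i.succAbove l) (by simpa using hkl)
    · rintro ⟨h₁, h₂⟩ k l hkl
      rcases Fin.eq_self_or_eq_succAbove i k with hk | ⟨k, rfl⟩ <;>
        rcases Fin.eq_self_or_eq_succAbove i l with hl | ⟨l, rfl⟩
      · exact absurd (hk.trans hl.symm) hkl
      · simpa [hk, dist_comm] using h₁ l
      · simpa [hl] using h₁ k
      · simpa using h₂ k l (by simpa using hkl)
  unfold hardCore
  simp only [key]
  split_ifs <;> first | rfl | tauto

/-- A hard-core tuple has at most one coordinate in a set of diameter less than one. -/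
lemma indicator_pi_union_hardCore {n : ℕ} {A B : Set X} (hA : Metric.ediam A < 1)
    (hAB : Disjoint A B) (x : Fin n → X) :
    (Set.univ.pi fun _ => A ∪ B).indicator (hardCore n) x =
      (Set.univ.pi fun _ => B).indicator (hardCore n) x +
        ∑ i, (Set.univ.pi (Function.update (fun _ => B) i A)).indicator (hardCore n) x := by
  classical
  by_cases h : ∀ i j : Fin n, i ≠ j → 1 ≤ dist (x i) (x j)
  swap
  · have h0 : hardCore n x = 0 := if_neg h
    simp [Set.indicator_apply, h0]
  have hmem : ∀ i, x ∈ Set.univ.pi (Function.update (fun _ => B) i A) ↔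
      x i ∈ A ∧ ∀ j, j ≠ i → x j ∈ B := by
    intro i
    simp only [Set.mem_univ_pi]
    constructor
    · intro H
      exact ⟨by simpa using H i, fun j hj => by simpa [hj] using H j⟩
    · rintro ⟨H₁, H₂⟩ j
      by_cases hj : j = i
      · subst hj; simpa using H₁
      · simpa [hj] using H₂ j hj
  have hdisj : ∀ y, y ∈ A → y ∉ B := fun y hy => Set.disjoint_left.1 hAB hy
  have hone : ∀ i j, i ≠ j → x i ∈ A → x j ∉ A := by
    intro i j hij hi hj
    have h₁ : edist (x i) (x j) < 1 := (Metric.edist_le_ediam_of_mem hi hj).trans_lt hA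
    rw [edist_dist, ENNReal.ofReal_lt_one] at h₁
    exact absurd (h i j hij) (not_le.2 h₁)
  by_cases hB : ∀ i, x i ∈ B
  · have h₁ : x ∈ Set.univ.pi fun _ : Fin n => A ∪ B := fun i _ => Or.inr (hB i)
    have h₂ : x ∈ Set.univ.pi fun _ : Fin n => B := fun i _ => hB i
    rw [Set.indicator_of_mem h₁, Set.indicator_of_mem h₂, Finset.sum_eq_zero, add_zero]
    exact fun i _ => Set.indicator_of_notMem (fun H => hdisj _ ((hmem i).1 H).1 (hB i)) _
  · push Not at hB
    obtain ⟨i, hi⟩ := hB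
    have h₂ : x ∉ Set.univ.pi fun _ : Fin n => B := fun H => hi (H i trivial)
    rw [Set.indicator_of_notMem h₂, zero_add, Finset.sum_eq_single i]
    · have : (x ∈ Set.univ.pi fun _ : Fin n => A ∪ B) ↔
          x ∈ Set.univ.pi (Function.update (fun _ => B) i A) := by
        rw [hmem]
        simp only [Set.mem_univ_pi, Set.mem_union]
        constructor
        · intro H
          have hiA := (H i).resolve_right hi
          exact ⟨hiA, fun j hj => (H j).resolve_left (hone i j hj.symm hiA)⟩
        · rintro ⟨H₁, H₂⟩ j
          by_cases hj : j = i
          · exact Or.inl (hj ▸ H₁)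
          · exact Or.inr (H₂ j hj)
      simp only [Set.indicator_apply, this]
    · exact fun j _ hj => Set.indicator_of_notMem (fun H => hi (((hmem j).1 H).2 i hj.symm)) _
    · simp

variable [MeasurableSpace X]

/-- The weight of hard-core `n`-tuples in `B`. -/
noncomputable def hardCoreWeight (n : ℕ) (B : Set X) (M : Measure X) : ℝ :=
  ∫ x in (Set.univ.pi fun _ : Fin n => B), hardCore n x ∂(Measure.pi fun _ : Fin n => M)

lemma genZ_eq_tsum (B : Set X) (M : Measure X) :
    genZ B M = ∑' n : ℕ, ((-1 : ℝ) ^ n / n.factorial) * hardCoreWeight n B M := rfl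

lemma hardCoreWeight_nonneg (n : ℕ) (B : Set X) (M : Measure X) :
    0 ≤ hardCoreWeight n B M :=
  integral_nonneg fun _ => hardCore_nonneg _ _

variable {M : Measure X} [SigmaFinite M]

lemma hardCoreWeight_le {B C : Set X} (hCB : C ⊆ B) (hB : M B ≠ ⊤) (n : ℕ) :
    hardCoreWeight n C M ≤ M.real B ^ n := by
  have hC : M C ≠ ⊤ := measure_ne_top_of_subset hCB hB
  have h₁ : hardCoreWeight n C M ≤ M.real C ^ n := by
    have hfin : (Measure.pi fun _ : Fin n => M) (Set.univ.pi fun _ => C) < ⊤ := by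
      rw [Measure.pi_pi]
      exact (ENNReal.prod_ne_top fun i _ => hC).lt_top
    have := norm_setIntegral_le_of_norm_le_const (f := hardCore n) (C := 1) hfin
      (fun x _ => by
        rw [Real.norm_of_nonneg (hardCore_nonneg _ _)]
        exact hardCore_le_one _ _)
    refine (Real.le_norm_self _).trans (this.trans_eq ?_)
    simp [Measure.real, Measure.pi_pi]
  refine h₁.trans (pow_le_pow_left₀ measureReal_nonneg (measureReal_mono hCB hB) n)

lemma summable_hardCoreWeight {B : Set X} (hB : M B ≠ ⊤) :
    Summable fun n : ℕ => ((-1 : ℝ) ^ n / n.factorial) * hardCoreWeight n B M := by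
  refine Summable.of_norm_bounded (Real.summable_pow_div_factorial (M.real B)) fun n => ?_
  rw [norm_mul, norm_div, norm_pow, norm_neg, norm_one, one_pow, RCLike.norm_natCast,
    Real.norm_of_nonneg (hardCoreWeight_nonneg _ _ _), one_div, inv_mul_eq_div]
  gcongr
  exact hardCoreWeight_le subset_rfl hB n

variable [BorelSpace X] [SecondCountableTopology X]

lemma measurable_hardCore (n : ℕ) :
    Measurable (hardCore n : (Fin n → X) → ℝ) := by
  refine Measurable.ite ?_ measurable_const measurable_const
  simp only [Set.ofPred_forall]
  refine MeasurableSet.iInter fun i => MeasurableSet.iInter fun j => MeasurableSet.iInter fun _ => ?_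
  exact measurableSet_le measurable_const (by fun_prop)

lemma integrableOn_hardCore {n : ℕ} {S : Fin n → Set X} (hS : ∀ i, M (S i) ≠ ⊤) :
    IntegrableOn (hardCore n) (Set.univ.pi S) (Measure.pi fun _ => M) := by
  refine Measure.integrableOn_of_bounded (M := 1) ?_
    (measurable_hardCore n).aestronglyMeasurable (ae_of_all _ fun x => ?_)
  · rw [Measure.pi_pi]
    exact ENNReal.prod_ne_top fun i _ => hS i
  · rw [Real.norm_of_nonneg (hardCore_nonneg _ _)]
    exact hardCore_le_one _ _

/-- Disintegration along the coordinate that lies in `A`. -/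
lemma setIntegral_hardCore_update {n : ℕ} {A B : Set X} (hAm : MeasurableSet A)
    (hBm : MeasurableSet B) (hA : M A ≠ ⊤) (hB : M B ≠ ⊤) (i : Fin (n + 1)) :
    IntegrableOn (fun a => hardCoreWeight n (B \ ball a 1) M) A M ∧
    ∫ x in Set.univ.pi (Function.update (fun _ => B) i A), hardCore (n + 1) x
        ∂(Measure.pi fun _ => M) =
      ∫ a in A, hardCoreWeight n (B \ ball a 1) M ∂M := by
  classical
  set S : Set (Fin (n + 1) → X) := Set.univ.pi (Function.update (fun _ => B) i A) with hS
  have hSm : MeasurableSet S := by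
    refine MeasurableSet.univ_pi fun j => ?_
    by_cases hj : j = i
    · subst hj; simpa using hAm
    · simpa [hj] using hBm
  have hmp := (measurePreserving_piFinSuccAbove (fun _ : Fin (n + 1) => M) i).symm
  set e := (MeasurableEquiv.piFinSuccAbove (fun _ : Fin (n + 1) => X) i).symm with he
  have heq : ∀ a y, S.indicator (hardCore (n + 1)) (e (a, y)) =
      A.indicator (fun a => (Set.univ.pi fun _ => B \ ball a 1).indicator (hardCore n) y) a := by
    intro a y
    have he' : e (a, y) = (i.insertNth a y : Fin (n + 1) → X) := rfl
    have hmem : (i.insertNth a y : Fin (n + 1) → X) ∈ S ↔ a ∈ A ∧ ∀ j, y j ∈ B := by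
      rw [hS, Set.mem_univ_pi, Fin.forall_iff_succAbove i]
      simp
    rw [he']
    simp only [Set.indicator_apply, hmem, hardCore_insertNth, Set.mem_univ_pi, Set.mem_sdiff,
      forall_and]
    split_ifs <;> first | rfl | tauto
  have hint : Integrable (S.indicator (hardCore (n + 1))) (Measure.pi fun _ => M) := by
    rw [integrable_indicator_iff hSm]
    refine integrableOn_hardCore fun j => ?_
    by_cases hj : j = i
    · subst hj; simpa using hA
    · simpa [hj] using hB
  have hint' := (hmp.integrable_comp_emb e.measurableEmbedding).2 hint
  have hinner : ∀ a, ∫ y, (S.indicator (hardCore (n + 1)) ∘ e) (a, y) ∂(Measure.pi fun _ => M) =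
      A.indicator (fun a => hardCoreWeight n (B \ ball a 1) M) a := by
    intro a
    simp only [Function.comp_apply, heq]
    by_cases ha : a ∈ A
    · simp only [Set.indicator_of_mem ha]
      rw [integral_indicator (MeasurableSet.univ_pi fun _ => hBm.diff measurableSet_ball)]
      rfl
    · simp [Set.indicator_of_notMem ha]
  constructor
  · rw [← integrable_indicator_iff hAm]
    refine (Integrable.integral_prod_left hint').congr (ae_of_all _ hinner)
  · rw [← integral_indicator hSm, ← integral_indicator hAm,
      ← hmp.integral_comp e.measurableEmbedding]
    refine (integral_prod _ hint').trans ?_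
    exact integral_congr_ae (ae_of_all _ hinner)

lemma hardCoreWeight_succ_union {A B : Set X} (hAm : MeasurableSet A)
    (hBm : MeasurableSet B) (hA : M A ≠ ⊤) (hB : M B ≠ ⊤) (hAd : Metric.ediam A < 1)
    (hAB : Disjoint A B) (n : ℕ) :
    hardCoreWeight (n + 1) (A ∪ B) M = hardCoreWeight (n + 1) B M +
      (n + 1) * ∫ a in A, hardCoreWeight n (B \ ball a 1) M ∂M := by
  classical
  have hm : ∀ i : Fin (n + 1),
      MeasurableSet (Set.univ.pi (Function.update (fun _ => B) i A)) := by
    refine fun i => MeasurableSet.univ_pi fun j => ?_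
    by_cases hj : j = i
    · subst hj; simpa using hAm
    · simpa [hj] using hBm
  have hBpi : MeasurableSet (Set.univ.pi fun _ : Fin (n + 1) => B) :=
    MeasurableSet.univ_pi fun _ => hBm
  have hi : ∀ i : Fin (n + 1), Integrable
      ((Set.univ.pi (Function.update (fun _ => B) i A)).indicator (hardCore (n + 1)))
      (Measure.pi fun _ => M) := by
    intro i
    rw [integrable_indicator_iff (hm i)]
    refine integrableOn_hardCore fun j => ?_
    by_cases hj : j = i
    · subst hj; simpa using hA
    · simpa [hj] using hB
  have hiB : Integrable ((Set.univ.pi fun _ => B).indicator (hardCore (n + 1)))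
      (Measure.pi fun _ => M) := by
    rw [integrable_indicator_iff hBpi]
    exact integrableOn_hardCore fun _ => hB
  unfold hardCoreWeight
  rw [← integral_indicator (MeasurableSet.univ_pi fun _ => hAm.union hBm),
    ← integral_indicator hBpi]
  simp_rw [indicator_pi_union_hardCore hAd hAB]
  rw [integral_add hiB (integrable_finsetSum _ fun i _ => hi i),
    integral_finsetSum _ fun i _ => hi i]
  congr 1
  have : ∀ i : Fin (n + 1), ∫ x, (Set.univ.pi (Function.update (fun _ => B) i A)).indicator
      (hardCore (n + 1)) x ∂(Measure.pi fun _ => M) =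
      ∫ a in A, hardCoreWeight n (B \ ball a 1) M ∂M := by
    intro i
    rw [integral_indicator (hm i)]
    exact (setIntegral_hardCore_update hAm hBm hA hB i).2
  simp_rw [this]
  simp [hardCoreWeight]

/-- The fundamental identity: at most one point lies in a set of diameter less than one. -/
lemma genZ_union {A B : Set X} (hAm : MeasurableSet A) (hBm : MeasurableSet B)
    (hA : M A ≠ ⊤) (hB : M B ≠ ⊤) (hAd : Metric.ediam A < 1) (hAB : Disjoint A B) :
    genZ (A ∪ B) M = genZ B M - ∫ a in A, genZ (B \ ball a 1) M ∂M := by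
  have hU : M (A ∪ B) ≠ ⊤ := measure_union_ne_top hA hB
  set J : ℕ → ℝ := fun n => ∫ a in A, hardCoreWeight n (B \ ball a 1) M ∂M with hJ
  have hInt : ∀ n, IntegrableOn (fun a => hardCoreWeight n (B \ ball a 1) M) A M :=
    fun n => (setIntegral_hardCore_update hAm hBm hA hB 0).1
  have hJle : ∀ n, J n ≤ M.real B ^ n * M.real A := by
    intro n
    refine (setIntegral_mono (hInt n) (integrableOn_const hA)
      fun a => hardCoreWeight_le Set.sdiff_subset hB n).trans_eq ?_
    simp [mul_comm]
  have hswap : HasSum (fun n : ℕ => (-1 : ℝ) ^ n / n.factorial * J n)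
      (∫ a in A, genZ (B \ ball a 1) M ∂M) := by
    have := hasSum_integral_of_summable_integral_norm (μ := M.restrict A)
      (F := fun (n : ℕ) a => (-1 : ℝ) ^ n / n.factorial * hardCoreWeight n (B \ ball a 1) M)
      (fun n => (hInt n).const_mul _) ?_
    · simp only [integral_const_mul] at this
      exact this
    · refine Summable.of_nonneg_of_le (fun n => integral_nonneg fun _ => norm_nonneg _)
        (fun n => ?_) ((Real.summable_pow_div_factorial (M.real B)).mul_right (M.real A))
      have : ∀ a, ‖(-1 : ℝ) ^ n / n.factorial * hardCoreWeight n (B \ ball a 1) M‖ =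
          (n.factorial : ℝ)⁻¹ * hardCoreWeight n (B \ ball a 1) M := by
        intro a
        rw [norm_mul, norm_div, norm_pow, norm_neg, norm_one, one_pow, RCLike.norm_natCast,
          Real.norm_of_nonneg (hardCoreWeight_nonneg _ _ _), one_div]
      simp_rw [this, integral_const_mul]
      rw [div_mul_eq_mul_div, div_eq_inv_mul]
      exact mul_le_mul_of_nonneg_left (hJle n) (by positivity)
  rw [← hswap.tsum_eq, genZ_eq_tsum, genZ_eq_tsum,
    (summable_hardCoreWeight hU).tsum_eq_zero_add, (summable_hardCoreWeight hB).tsum_eq_zero_add,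
    add_sub_assoc, ← ((summable_nat_add_iff 1).2 (summable_hardCoreWeight hB)).tsum_sub hswap.summable]
  congr 1
  · have h0 : ∀ C D : Set X, hardCoreWeight 0 C M = hardCoreWeight 0 D M := fun C D => by
      have : (Set.univ.pi fun _ : Fin 0 => C) = Set.univ.pi fun _ => D := by
        ext x; simp
      rw [hardCoreWeight, hardCoreWeight, this]
    rw [h0 (A ∪ B) B]
  · refine tsum_congr fun n => ?_
    rw [hardCoreWeight_succ_union hAm hBm hA hB hAd hAB, Nat.factorial_succ]
    have : (n.factorial : ℝ) ≠ 0 := by positivity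
    push_cast
    field_simp
    ring

end HardCore

lemma exists_finite_partition_of_kappa_lt_top {X : Type*} [MetricSpace X] [MeasurableSpace X]
    {B : Set X} (hB : kappa B < ⊤) :
    ∃ m : ℕ, ∃ A : Fin m → Set X, (∀ i, MeasurableSet (A i)) ∧
      (∀ i, Metric.ediam (A i) < 1) ∧ B = ⋃ i, A i := by
  obtain ⟨_, ⟨m, _, A, h₁, h₂, _, h₃⟩, _⟩ := sInf_lt_iff.1 hB
  exact ⟨m, A, h₁, h₂, h₃⟩

lemma isBounded_of_kappa_lt_top {X : Type*} [MetricSpace X] [MeasurableSpace X]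
    {B : Set X} (hB : kappa B < ⊤) : Bornology.IsBounded B := by
  obtain ⟨m, A, _, h, rfl⟩ := exists_finite_partition_of_kappa_lt_top hB
  exact Bornology.isBounded_iUnion.2 fun i =>
    Metric.isBounded_iff_ediam_ne_top.2 (h i).ne_top

/-- If `M ∈ 𝓜^sh` and `A`, `B` are Borel sets of finite unit partition number with
`Z(B, M) > 0`, then `z(A, B) = Z(A ∪ B, M)/Z(B, M) ≤ 1`, i.e.
`Z(A ∪ B, M) ≤ Z(B, M)`. -/
theorem stmt18 {X : Type*} [MetricSpace X] [CompleteSpace X]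
    [TopologicalSpace.SeparableSpace X] [MeasurableSpace X] [BorelSpace X]
    (M : Measure X) (hM : ∀ s : Set X, Bornology.IsBounded s → M s < ⊤)
    (hsh : ∀ B : Set X, MeasurableSet B → Bornology.IsBounded B → 0 ≤ genZ B M)
    (A B : Set X) (hAm : MeasurableSet A) (hBm : MeasurableSet B)
    (hAk : kappa A < ⊤) (hBk : kappa B < ⊤) (hZB : 0 < genZ B M) :
    genZ (A ∪ B) M / genZ B M ≤ 1 ∧ genZ (A ∪ B) M ≤ genZ B M := by
  have : SecondCountableTopology X := UniformSpace.secondCountable_of_separable X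
  have : IsLocallyFiniteMeasure M :=
    ⟨fun x => ⟨ball x 1, ball_mem_nhds x one_pos, hM _ isBounded_ball⟩⟩
  have hbB := isBounded_of_kappa_lt_top hBk
  have step : ∀ C D : Set X, MeasurableSet C → MeasurableSet D → Metric.ediam C < 1 →
      Bornology.IsBounded D → genZ (C ∪ D) M ≤ genZ D M := by
    intro C D hC hD hCd hDb
    have hd : Metric.ediam (C \ D) < 1 := (Metric.ediam_mono Set.sdiff_subset).trans_lt hCd
    rw [← Set.sdiff_union_self, genZ_union (hC.diff hD) hD
      (hM _ (Metric.isBounded_iff_ediam_ne_top.2 hd.ne_top)).ne (hM _ hDb).ne hd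
      Set.disjoint_sdiff_left]
    exact sub_le_self _ (integral_nonneg fun a =>
      hsh _ (hD.diff measurableSet_ball) (hDb.subset Set.sdiff_subset))
  obtain ⟨m, P, hPm, hPd, rfl⟩ := exists_finite_partition_of_kappa_lt_top hAk
  have main : ∀ s : Finset (Fin m), genZ ((⋃ i ∈ s, P i) ∪ B) M ≤ genZ B M := by
    classical
    intro s
    induction s using Finset.induction_on with
    | empty => simp
    | insert i s _ ih =>
      rw [Finset.set_biUnion_insert, Set.union_assoc]
      refine (step _ _ (hPm i) ((s.measurableSet_biUnion fun j _ => hPm j).union hBm)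
        (hPd i) (Bornology.IsBounded.union ?_ hbB)).trans ih
      exact (Bornology.isBounded_biUnion_finset s).2 fun j _ =>
        Metric.isBounded_iff_ediam_ne_top.2 (hPd j).ne_top
  have h : genZ ((⋃ i, P i) ∪ B) M ≤ genZ B M := by simpa using main Finset.univ
  exact ⟨(div_le_one hZB).2 h, h⟩
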